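/- Let Y = X ∪ α be the closure in ℝ² of the bouquet X = ⋃_{n≥2} C_n of triangle boundaries based at p = (0,0), with α the segment from (0,0) to (0,1). Then Y is semilocally simply connected at every point, yet π₁(Y,p) is not discrete. Hence 'π₁(Y,p) discrete iff Y semilocally simply connected' is false in general (without local path connectedness). -/

import Mathlib

open unitInterval Topology

noncomputable section

/-- The topological fundamental group: path components of the based loop space
(compact-open topology), with the quotient topology. -/
def piTop (Z : Type*) [TopologicalSpace Z] (z : Z) : Type _ :=
  Quotient (pathSetoid (Path z z))

instance (Z : Type*) [TopologicalSpace Z] (z : Z) : TopologicalSpace (piTop Z z) :=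
  instTopologicalSpaceQuotient

/-- The class of a loop in the topological fundamental group. -/
def piMk {Z : Type*} [TopologicalSpace Z] {z : Z} (γ : Path z z) : piTop Z z :=
  Quotient.mk _ γ

/-- The common basepoint `p = (0,0)`. -/
def pp : ℝ × ℝ := (0, 0)

/-- The apex `(1/n, 1)` of the `n`-th triangle. -/
def apex (n : ℕ) : ℝ × ℝ := (1 / (n : ℝ), 1)

/-- The third vertex `(1/n,1) + 10^{-10n}·(n,-1)` of the `n`-th triangle. -/
def apex' (n : ℕ) : ℝ × ℝ := apex n + (((10 : ℝ) ^ (10 * n))⁻¹) • ((n : ℝ), -1)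

/-- The boundary of the `n`-th triangle, i.e. the union of its three edges. -/
def Cset (n : ℕ) : Set (ℝ × ℝ) :=
  segment ℝ pp (apex n) ∪ segment ℝ (apex n) (apex' n) ∪ segment ℝ (apex' n) pp

/-- The bouquet `X = ⋃_{n ≥ 2} C_n`. -/
def Xset : Set (ℝ × ℝ) := ⋃ n ∈ {n : ℕ | 2 ≤ n}, Cset n

/-- The segment `α` from `(0,0)` to `(0,1)`. -/
def alphaSet : Set (ℝ × ℝ) := segment ℝ (0, 0) (0, 1)

/-- The compactification `Y = X ∪ α`. -/
def Yset : Set (ℝ × ℝ) := Xset ∪ alphaSet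

lemma pp_mem_C (n : ℕ) : pp ∈ Cset n := Or.inl (Or.inl (left_mem_segment ℝ _ _))

lemma pp_mem_X : pp ∈ Xset :=
  Set.mem_biUnion (by norm_num : (2 : ℕ) ∈ {n : ℕ | 2 ≤ n}) (pp_mem_C 2)

lemma X_sub_Y : Xset ⊆ Yset := Set.subset_union_left

lemma pp_mem_Y : pp ∈ Yset := X_sub_Y pp_mem_X

/-- The basepoint of `X`. -/
def pX : ↥Xset := ⟨pp, pp_mem_X⟩

/-- The basepoint of `Y`. -/
def pY : ↥Yset := ⟨pp, pp_mem_Y⟩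

/-- The inclusion `X ↪ Y` as a continuous map between subspaces. -/
def jXY : C(↥Xset, ↥Yset) := ⟨Set.inclusion X_sub_Y, continuous_inclusion X_sub_Y⟩

lemma jXY_pX : jXY pX = pY := rfl

/-- The size `10^{-10n}` of the `n`-th top edge. -/
def eps (n : ℕ) : ℝ := ((10 : ℝ) ^ (10 * n))⁻¹

lemma eps_pos (n : ℕ) : 0 < eps n := by unfold eps; positivity

lemma eps_bound (n : ℕ) (hn : 2 ≤ n) : 100 * (n : ℝ) ^ 3 * eps n ≤ 1 := by
  have h1 : (n : ℝ) ≤ 10 ^ n := by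
    exact_mod_cast (Nat.lt_pow_self (by norm_num : 1 < 10)).le
  have h2 : (100 : ℝ) ≤ 10 ^ n := by
    calc (100 : ℝ) = 10 ^ 2 := by norm_num
      _ ≤ 10 ^ n := pow_le_pow_right₀ (by norm_num) hn
  have h3 : (10 : ℝ) ^ (10 * n) = (10 ^ n) ^ 10 := by rw [← pow_mul, mul_comm]
  unfold eps
  rw [mul_inv_le_iff₀ (by positivity), one_mul, h3]
  have hn0 : (0 : ℝ) ≤ n := by positivity
  calc 100 * (n : ℝ) ^ 3 ≤ 10 ^ n * (10 ^ n) ^ 3 := by gcongr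
    _ = (10 ^ n) ^ 4 := by ring
    _ ≤ (10 ^ n) ^ 10 := pow_le_pow_right₀ (by linarith) (by norm_num)

/-- Polar-type coordinates adapted to the `n`-th triangle. -/
def pt (n : ℕ) (l c : ℝ) : ℝ × ℝ := (l * (1 / n + c * (eps n * n)), l * (1 - c * eps n))

lemma apex'_eq (n : ℕ) : apex' n = (1 / (n : ℝ) + eps n * n, 1 - eps n) := by
  simp [apex', apex, eps, sub_eq_add_neg]

lemma pt_mem (n : ℕ) (l c : ℝ) (hl : 0 ≤ l) (hl1 : l ≤ 1) (hc : 0 ≤ c) (hc1 : c ≤ 1)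
    (h : c = 0 ∨ c = 1 ∨ l = 1) : pt n l c ∈ Cset n := by
  rcases h with rfl | rfl | rfl
  · refine Or.inl (Or.inl ⟨1 - l, l, by linarith, hl, by ring, ?_⟩)
    simp [pp, apex, pt]
  · refine Or.inr ⟨l, 1 - l, hl, by linarith, by ring, ?_⟩
    rw [apex'_eq]
    simp [pp, pt]
  · refine Or.inl (Or.inr ⟨1 - c, c, by linarith, hc, by ring, ?_⟩)
    rw [apex'_eq]
    simp only [apex, pt, Prod.smul_mk, smul_eq_mul, Prod.mk_add_mk, Prod.mk.injEq]
    constructor <;> ring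

lemma mem_C_pt (n : ℕ) (z : ℝ × ℝ) (hz : z ∈ Cset n) : ∃ l c : ℝ, 0 ≤ l ∧ l ≤ 1 ∧ 0 ≤ c ∧ c ≤ 1 ∧
    (c = 0 ∨ c = 1 ∨ l = 1) ∧ z = pt n l c := by
  rcases hz with (⟨a, b, ha, hb, hab, rfl⟩ | ⟨a, b, ha, hb, hab, rfl⟩) | ⟨a, b, ha, hb, hab, rfl⟩
  · refine ⟨b, 0, hb, by linarith, le_rfl, by norm_num, Or.inl rfl, ?_⟩
    simp [pp, apex, pt]
  · refine ⟨1, b, by norm_num, le_rfl, hb, by linarith, Or.inr (Or.inr rfl), ?_⟩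
    rw [apex'_eq]
    obtain rfl : a = 1 - b := by linarith
    simp only [apex, pt, Prod.smul_mk, smul_eq_mul, Prod.mk_add_mk, Prod.mk.injEq]
    constructor <;> ring
  · refine ⟨a, 1, ha, by linarith, by norm_num, le_rfl, Or.inr (Or.inl rfl), ?_⟩
    rw [apex'_eq]
    simp [pp, pt]

lemma mem_alpha (z : ℝ × ℝ) : z ∈ alphaSet ↔ z.1 = 0 ∧ 0 ≤ z.2 ∧ z.2 ≤ 1 := by
  constructor
  · rintro ⟨a, b, ha, hb, hab, rfl⟩
    simp; constructor <;> linarith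
  · rintro ⟨h1, h2, h3⟩
    refine ⟨1 - z.2, z.2, by linarith, h2, by ring, ?_⟩
    ext <;> simp [h1]

lemma mem_Y (z : ℝ × ℝ) : z ∈ Yset ↔ (∃ n, 2 ≤ n ∧ z ∈ Cset n) ∨ z ∈ alphaSet := by
  simp [Yset, Xset]

lemma eps_le (n : ℕ) (hn : 2 ≤ n) : eps n ≤ 1 / 100 := by
  have := eps_bound n hn
  have h2 : (1 : ℝ) ≤ n := by exact_mod_cast (by omega : 1 ≤ n)
  have h3 : (1 : ℝ) ≤ (n : ℝ) ^ 3 := one_le_pow₀ h2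
  nlinarith [eps_pos n]

lemma pt_snd_lower (n : ℕ) (hn : 2 ≤ n) (c : ℝ) (hc : 0 ≤ c) (hc1 : c ≤ 1) :
    1 / 2 < 1 - c * eps n := by
  nlinarith [eps_le n hn, eps_pos n]

lemma pt_pos (n : ℕ) (hn : 2 ≤ n) (l c : ℝ) (hl : 0 ≤ l) (hc : 0 ≤ c) (hc1 : c ≤ 1)
    (h : (pt n l c).2 ≠ 0) : 0 < l := by
  rcases hl.eq_or_lt with rfl | h'
  · simp [pt] at h
  · exact h'

/-- Linear functional separating the triangles with index `< k` from those with index `≥ k`. -/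
def hsep (k : ℕ) (z : ℝ × ℝ) : ℝ := (2 * k - 1) * z.1 - 2 * z.2

lemma Y_snd_nonneg (z : ℝ × ℝ) (hz : z ∈ Yset) : 0 ≤ z.2 := by
  rcases (mem_Y z).1 hz with ⟨n, hn, h⟩ | h
  · obtain ⟨l, c, hl, hl1, hc, hc1, -, rfl⟩ := mem_C_pt n z h
    have := pt_snd_lower n hn c hc hc1
    simp only [pt]; positivity
  · exact ((mem_alpha z).1 h).2.1

lemma Y_fst_nonneg (z : ℝ × ℝ) (hz : z ∈ Yset) : 0 ≤ z.1 := by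
  rcases (mem_Y z).1 hz with ⟨n, hn, h⟩ | h
  · obtain ⟨l, c, hl, hl1, hc, hc1, -, rfl⟩ := mem_C_pt n z h
    have := eps_pos n
    simp only [pt]; positivity
  · exact ((mem_alpha z).1 h).1.ge

lemma hsep_pos (k m : ℕ) (hm : 2 ≤ m) (hmk : m < k) (z : ℝ × ℝ) (hz : z ∈ Cset m)
    (h0 : z.2 ≠ 0) : 0 < hsep k z := by
  obtain ⟨l, c, hl, hl1, hc, hc1, -, rfl⟩ := mem_C_pt m z hz
  have hl0 := pt_pos m hm l c hl hc hc1 h0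
  have he := eps_pos m
  have hm' : (2 : ℝ) ≤ m := by exact_mod_cast hm
  have hk' : (m : ℝ) + 1 ≤ k := by exact_mod_cast hmk
  have e : hsep k (pt m l c)
      = l * ((2 * k - 1 - 2 * m) / m + c * eps m * ((2 * k - 1) * m + 2)) := by
    simp only [hsep, pt]; field_simp; ring
  rw [e]
  have h1 : 0 < (2 * (k : ℝ) - 1 - 2 * m) / m := div_pos (by linarith) (by linarith)
  have h2 : 0 ≤ c * eps m * ((2 * (k : ℝ) - 1) * m + 2) := by
    have : 0 ≤ 2 * (k : ℝ) - 1 := by linarith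
    positivity
  exact mul_pos hl0 (by linarith)

lemma hsep_neg (k m : ℕ) (hk : 2 ≤ k) (hmk : k ≤ m) (z : ℝ × ℝ) (hz : z ∈ Cset m)
    (h0 : z.2 ≠ 0) : hsep k z < 0 := by
  obtain ⟨l, c, hl, hl1, hc, hc1, -, rfl⟩ := mem_C_pt m z hz
  have hm : 2 ≤ m := hk.trans hmk
  have hl0 := pt_pos m hm l c hl hc hc1 h0
  have he := eps_pos m
  have hb := eps_bound m hm
  have hm' : (2 : ℝ) ≤ m := by exact_mod_cast hm
  have hk2 : (2 : ℝ) ≤ k := by exact_mod_cast hk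
  have hk' : (k : ℝ) ≤ m := by exact_mod_cast hmk
  have e : hsep k (pt m l c)
      = l / m * ((2 * k - 1 - 2 * m) + c * eps m * (((2 * k - 1) * m + 2) * m)) := by
    simp only [hsep, pt]; field_simp; ring
  rw [e]
  have h2 : ((2 * (k : ℝ) - 1) * m + 2) * m ≤ 4 * m ^ 3 := by
    have : ((2 * (k : ℝ) - 1) * m + 2) ≤ 4 * m ^ 2 := by nlinarith
    nlinarith
  have h3 : c * eps m * (((2 * k - 1) * m + 2) * m) ≤ 1 * eps m * (4 * m ^ 3) := by
    have : 0 ≤ (2 * (k : ℝ) - 1) := by linarith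
    gcongr
  refine mul_neg_of_pos_of_neg (by positivity) ?_
  linarith

lemma hsep_alpha (k : ℕ) (z : ℝ × ℝ) (hz : z ∈ alphaSet) (h0 : z.2 ≠ 0) : hsep k z < 0 := by
  obtain ⟨h1, h2, h3⟩ := (mem_alpha z).1 hz
  have := lt_of_le_of_ne h2 h0.symm
  simp [hsep, h1, this]

lemma hsep_ne (k : ℕ) (hk : 2 ≤ k) (z : ℝ × ℝ) (hz : z ∈ Yset) (h0 : z.2 ≠ 0) : hsep k z ≠ 0 := by
  rcases (mem_Y z).1 hz with ⟨n, hn, h⟩ | h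
  · rcases lt_or_ge n k with h' | h'
    · exact (hsep_pos k n hn h' z h h0).ne'
    · exact (hsep_neg k n hk h' z h h0).ne
  · exact (hsep_alpha k z h h0).ne

lemma hsep_const (k : ℕ) (hk : 2 ≤ k) (f : I → ℝ × ℝ) (hf : Continuous f) (hY : ∀ t, f t ∈ Yset)
    (h0 : ∀ t, (f t).2 ≠ 0) (h : hsep k (f 0) < 0) (t : I) : hsep k (f t) < 0 := by
  by_contra hcon
  have hc : Continuous fun t => hsep k (f t) := by unfold hsep; fun_prop
  obtain ⟨s, hs⟩ := mem_range_of_exists_le_of_exists_ge hc ⟨0, h.le⟩ ⟨t, not_lt.1 hcon⟩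
  exact hsep_ne k hk _ (hY s) (h0 s) hs

lemma hsep_const' (k : ℕ) (hk : 2 ≤ k) (f : I → ℝ × ℝ) (hf : Continuous f) (hY : ∀ t, f t ∈ Yset)
    (h0 : ∀ t, (f t).2 ≠ 0) (h : 0 < hsep k (f 0)) (t : I) : 0 < hsep k (f t) := by
  by_contra hcon
  have hc : Continuous fun t => hsep k (f t) := by unfold hsep; fun_prop
  obtain ⟨s, hs⟩ := mem_range_of_exists_le_of_exists_ge hc ⟨t, not_lt.1 hcon⟩ ⟨0, h.le⟩
  exact hsep_ne k hk _ (hY s) (h0 s) hs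

lemma stay_alpha (f : I → ℝ × ℝ) (hf : Continuous f) (hY : ∀ t, f t ∈ Yset)
    (h0 : ∀ t, (f t).2 ≠ 0) (h : f 0 ∈ alphaSet) (t : I) : f t ∈ alphaSet := by
  rcases (mem_Y _).1 (hY t) with ⟨n, hn, h'⟩ | h'
  · have h1 := hsep_const (n + 1) (by omega) f hf hY h0 (hsep_alpha _ _ h (h0 0)) t
    have h2 := hsep_pos (n + 1) n hn (by omega) _ h' (h0 t)
    exact absurd h1 h2.not_gt
  · exact h'

lemma stay_C (n : ℕ) (hn : 2 ≤ n) (f : I → ℝ × ℝ) (hf : Continuous f) (hY : ∀ t, f t ∈ Yset)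
    (h0 : ∀ t, (f t).2 ≠ 0) (h : f 0 ∈ Cset n) (t : I) : f t ∈ Cset n := by
  have h1 := hsep_const n hn f hf hY h0 (hsep_neg n n hn le_rfl _ h (h0 0)) t
  have h2 := hsep_const' (n + 1) (by omega) f hf hY h0
    (hsep_pos (n + 1) n hn (by omega) _ h (h0 0)) t
  rcases (mem_Y _).1 (hY t) with ⟨m, hm, h'⟩ | h'
  · rcases lt_trichotomy m n with hlt | rfl | hlt
    · exact absurd h1 (hsep_pos n m hm hlt _ h' (h0 t)).not_gt
    · exact h'
    · exact absurd h2 (hsep_neg (n + 1) m (by omega) hlt _ h' (h0 t)).not_gt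
  · exact absurd h2 (hsep_alpha (n + 1) _ h' (h0 t)).not_gt

/-- Radial coordinate of the parametrized triangle. -/
def lam (s : ℝ) : ℝ := max 0 (min 1 (min (1 + s) (2 - s)))

/-- Angular coordinate of the parametrized triangle. -/
def cc (s : ℝ) : ℝ := max 0 (min 1 s)

lemma continuous_lam : Continuous lam := by unfold lam; fun_prop

lemma continuous_cc : Continuous cc := by unfold cc; fun_prop

lemma lam_nonneg (s : ℝ) : 0 ≤ lam s := le_max_left _ _

lemma lam_le (s : ℝ) : lam s ≤ 1 := max_le zero_le_one (min_le_left _ _)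

lemma cc_nonneg (s : ℝ) : 0 ≤ cc s := le_max_left _ _

lemma cc_le (s : ℝ) : cc s ≤ 1 := max_le zero_le_one (min_le_left _ _)

lemma cc_lam (s : ℝ) : cc s = 0 ∨ cc s = 1 ∨ lam s = 1 := by
  unfold cc lam; grind

lemma lam_k (l c : ℝ) (hl : 0 ≤ l) (hl1 : l ≤ 1) (hc : 0 ≤ c) (hc1 : c ≤ 1)
    (h : c = 0 ∨ c = 1 ∨ l = 1) : lam (c + (l - 1) * (1 - 2 * c)) = l := by
  unfold lam; rcases h with rfl | rfl | rfl <;> grind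

lemma cc_k (l c : ℝ) (hl : 0 ≤ l) (hl1 : l ≤ 1) (hc : 0 ≤ c) (hc1 : c ≤ 1)
    (h : c = 0 ∨ c = 1 ∨ l = 1) : cc (c + (l - 1) * (1 - 2 * c)) = c := by
  unfold cc; rcases h with rfl | rfl | rfl <;> grind

/-- Parametrization of the `n`-th triangle by the real line. -/
def gC (n : ℕ) (hn : 2 ≤ n) : C(ℝ, ↥Yset) where
  toFun s := ⟨pt n (lam s) (cc s), (mem_Y _).2 (Or.inl ⟨n, hn, pt_mem n _ _ (lam_nonneg s) (lam_le s)
    (cc_nonneg s) (cc_le s) (cc_lam s)⟩)⟩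
  continuous_toFun := by
    refine Continuous.subtype_mk ?_ _
    have := continuous_lam
    have := continuous_cc
    unfold pt; fun_prop

/-- Folded parametrization of the segment `α`. -/
def gA : C(ℝ, ↥Yset) where
  toFun s := ⟨(0, lam s), (mem_Y _).2 (Or.inr ((mem_alpha _).2 ⟨rfl, lam_nonneg s, lam_le s⟩))⟩
  continuous_toFun := by
    refine Continuous.subtype_mk ?_ _
    have := continuous_lam
    fun_prop

/-- The radial coordinate as a function of the point. -/
def Lf (n : ℕ) (z : ℝ × ℝ) : ℝ := n * (z.1 + n * z.2) / (1 + (n : ℝ) ^ 2)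

/-- The angular coordinate as a function of the point. -/
def cf (n : ℕ) (z : ℝ × ℝ) : ℝ := (n * z.1 - z.2) / (eps n * n * (z.1 + n * z.2))

lemma Lf_pt (n : ℕ) (hn : 2 ≤ n) (l c : ℝ) : Lf n (pt n l c) = l := by
  have : (n : ℝ) ≠ 0 := by positivity
  have : (1 + (n : ℝ) ^ 2) ≠ 0 := by positivity
  simp only [Lf, pt]; field_simp; ring

lemma cf_pt (n : ℕ) (hn : 2 ≤ n) (l c : ℝ) (hl : l ≠ 0) : cf n (pt n l c) = c := by
  have hn0 : (n : ℝ) ≠ 0 := by positivity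
  have h1 : (1 + (n : ℝ) ^ 2) ≠ 0 := by positivity
  have he := (eps_pos n).ne'
  have e : (pt n l c).1 + n * (pt n l c).2 = l * (1 + (n : ℝ) ^ 2) / n := by
    simp only [pt]; field_simp; ring
  have e' : n * (pt n l c).1 - (pt n l c).2 = l * c * eps n * (1 + (n : ℝ) ^ 2) := by
    simp only [pt]; field_simp; ring
  rw [cf, e, e']
  field_simp

lemma den_pos (n : ℕ) (hn : 2 ≤ n) (z : ℝ × ℝ) (hz : z ∈ Yset) (h0 : z.2 ≠ 0) :
    0 < eps n * n * (z.1 + n * z.2) := by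
  have h1 := Y_fst_nonneg z hz
  have h2 := lt_of_le_of_ne (Y_snd_nonneg z hz) h0.symm
  have := eps_pos n
  have : (0 : ℝ) < n := by positivity
  positivity

lemma factor_null {y : ↥Yset} (γ : Path y y) (g : C(ℝ, ↥Yset)) (f : I → ℝ) (hf : Continuous f)
    (h01 : f 0 = f 1) (h : ∀ t, g (f t) = γ t) : γ.Homotopic (Path.refl y) := by
  have hy : y = g (f 0) := by rw [h]; simp
  let q : Path (f 0) (f 0) := ⟨⟨f, hf⟩, rfl, h01.symm⟩
  have hq := (SimplyConnectedSpace.paths_homotopic q (Path.refl _)).map g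
  subst hy
  have e : γ = q.map g.continuous := by
    refine Path.ext (funext fun t => (h t).symm)
  rw [e]
  exact hq

lemma null_at_p (γ : Path pY pY) (h : ∀ t, (γ t).1.2 < 1 / 2) :
    γ.Homotopic (Path.refl pY) := by
  have key : ∀ z ∈ Yset, z.2 < 1 / 2 → ∀ r : ℝ, 0 ≤ r → r ≤ 1 → r • z ∈ Yset := by
    intro z hz hz2 r hr hr1
    rcases (mem_Y z).1 hz with ⟨n, hn, h⟩ | h
    · obtain ⟨l, c, hl, hl1, hc, hc1, hcl, rfl⟩ := mem_C_pt n z h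
      have hs := pt_snd_lower n hn c hc hc1
      have e : r • pt n l c = pt n (r * l) c := by
        simp [pt, mul_assoc]
      rw [e]
      refine (mem_Y _).2 (Or.inl ⟨n, hn, pt_mem n _ _ (by positivity) (by nlinarith) hc hc1 ?_⟩)
      rcases hcl with h | h | h
      · exact Or.inl h
      · exact Or.inr (Or.inl h)
      · subst h; simp only [pt] at hz2; linarith
    · obtain ⟨h1, h2, h3⟩ := (mem_alpha z).1 h
      refine (mem_Y _).2 (Or.inr ((mem_alpha _).2 ⟨?_, ?_, ?_⟩))
      · simp [h1]
      · simp; positivity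
      · simp; nlinarith
  refine ⟨⟨⟨⟨fun x => ⟨(1 - (x.1 : ℝ)) • (γ x.2).1, key _ (γ x.2).2 (h _) _ (by linarith [x.1.2.2])
    (by linarith [x.1.2.1])⟩, ?_⟩, ?_, ?_⟩, ?_⟩⟩
  · refine Continuous.subtype_mk ?_ _
    fun_prop
  · intro x; simp
  · intro x; ext <;> simp [pY, pp]
  · intro t x hx
    have e : γ x = pY := by
      rcases hx with rfl | hx
      · simp
      · rw [Set.mem_singleton_iff] at hx; subst hx; simp
    change (⟨(1 - (t : ℝ)) • (γ x).1, _⟩ : ↥Yset) = γ x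
    apply Subtype.ext
    change (1 - (t : ℝ)) • (γ x).1 = (γ x).1
    rw [e]; simp [pY, pp]

lemma snd_zero (z : ↥Yset) (h : z.1.2 = 0) : z = pY := by
  rcases (mem_Y z.1).1 z.2 with ⟨n, hn, h'⟩ | h'
  · obtain ⟨l, c, hl, hl1, hc, hc1, -, hz⟩ := mem_C_pt n z.1 h'
    have := pt_snd_lower n hn c hc hc1
    rw [hz] at h
    simp only [pt] at h
    have hl0 : l = 0 := by
      rcases mul_eq_zero.1 h with h | h
      · exact h
      · linarith
    apply Subtype.ext
    rw [hz, hl0]; simp [pt, pY, pp]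
  · apply Subtype.ext
    have := (mem_alpha _).1 h'
    exact Prod.ext this.1 h

lemma semiloc (y : ↥Yset) : ∃ U ∈ 𝓝 y, ∀ γ : Path y y,
      (∀ t : I, γ t ∈ U) → γ.Homotopic (Path.refl y) := by
  have hc2 : Continuous fun z : ↥Yset => z.1.2 := by fun_prop
  by_cases hy : y.1.2 = 0
  · obtain rfl := snd_zero y hy
    refine ⟨{z | z.1.2 < 1 / 2}, (isOpen_lt hc2 continuous_const).mem_nhds ?_, null_at_p⟩
    rw [Set.mem_ofPred_eq, hy]; norm_num
  · refine ⟨{z | z.1.2 ≠ 0}, (isOpen_ne_fun hc2 continuous_const).mem_nhds hy, fun γ hγ => ?_⟩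
    have hf : Continuous fun t => (γ t).1 := by fun_prop
    rcases (mem_Y y.1).1 y.2 with ⟨n, hn, h⟩ | h
    · have hst := stay_C n hn (fun t => (γ t).1) hf (fun t => (γ t).2) hγ (by simpa using h)
      refine factor_null γ (gC n hn) (fun t => cf n (γ t).1 + (Lf n (γ t).1 - 1) *
        (1 - 2 * cf n (γ t).1)) ?_ (by simp) ?_
      · have h1 : Continuous fun t => cf n (γ t).1 := by
          unfold cf
          refine Continuous.div (by fun_prop) (by fun_prop) fun t => ?_
          exact (den_pos n hn _ (γ t).2 (hγ t)).ne'
        have h2 : Continuous fun t => Lf n (γ t).1 := by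
          unfold Lf; fun_prop
        fun_prop
      · intro t
        obtain ⟨l, c, hl, hl1, hc, hc1, hcl, hz⟩ := mem_C_pt n _ (hst t)
        have hl0 : 0 < l := pt_pos n hn l c hl hc hc1 (hz ▸ hγ t)
        apply Subtype.ext
        rw [hz, Lf_pt n hn, cf_pt n hn _ _ hl0.ne']
        simp only [gC, ContinuousMap.coe_mk]
        rw [lam_k l c hl hl1 hc hc1 hcl, cc_k l c hl hl1 hc hc1 hcl]
    · have hst := stay_alpha (fun t => (γ t).1) hf (fun t => (γ t).2) hγ (by simpa using h)
      refine factor_null γ gA (fun t => (γ t).1.2 - 1) (by fun_prop) (by simp) ?_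
      intro t
      obtain ⟨h1, h2, h3⟩ := (mem_alpha _).1 (hst t)
      apply Subtype.ext
      refine Prod.ext h1.symm ?_
      change lam ((γ t).1.2 - 1) = (γ t).1.2
      unfold lam; grind

/-- The map `Y → ℝ/ℤ` detecting the `n`-th triangle. -/
def Fmap (n : ℕ) (z : ↥Yset) : AddCircle (1 : ℝ) := ((cc (cf n z.1) : ℝ) : AddCircle (1 : ℝ))

lemma coe_one' : ((1 : ℝ) : AddCircle (1 : ℝ)) = 0 := AddCircle.coe_period 1

lemma Fmap_low (n : ℕ) (hn : 2 ≤ n) (z : ↥Yset) (hz : z.1.2 < 1 / 2 ∨ z.1 ∈ alphaSet) :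
    Fmap n z = 0 := by
  by_cases h0 : z.1.2 = 0
  · have hz := snd_zero z h0
    subst hz
    simp [Fmap, cf, pY, pp, cc]
  have hden := den_pos n hn z.1 z.2 h0
  have hz1 := Y_fst_nonneg z.1 z.2
  have hz2 := lt_of_le_of_ne (Y_snd_nonneg z.1 z.2) (Ne.symm h0)
  have hn' : (2 : ℝ) ≤ n := by exact_mod_cast hn
  have hneg : hsep (n + 1) z.1 < 0 → Fmap n z = 0 := by
    intro h
    have : cf n z.1 ≤ 0 := by
      apply div_nonpos_of_nonpos_of_nonneg _ hden.le
      unfold hsep at h; push_cast at h; nlinarith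
    have : cc (cf n z.1) = 0 := by unfold cc; grind
    rw [Fmap, this]; simp
  have hpos : 0 < hsep n z.1 → Fmap n z = 0 := by
    intro h
    have hx : 1 ≤ cf n z.1 := by
      rw [cf, one_le_div hden]
      unfold hsep at h
      have hb := eps_bound n hn
      have he := eps_pos n
      have h1 : z.1.1 + n * z.1.2 ≤ 2 * (n : ℝ) ^ 2 * z.1.1 := by nlinarith
      have h2 : eps n * n * (z.1.1 + n * z.1.2) ≤ eps n * n * (2 * (n : ℝ) ^ 2 * z.1.1) := by
        gcongr
      have h3 : eps n * n * (2 * (n : ℝ) ^ 2 * z.1.1)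
          = (100 * (n : ℝ) ^ 3 * eps n) * (z.1.1 / 50) := by ring
      have h4 : (100 * (n : ℝ) ^ 3 * eps n) * (z.1.1 / 50) ≤ 1 * (z.1.1 / 50) := by gcongr
      linarith
    have : cc (cf n z.1) = 1 := by unfold cc; grind
    rw [Fmap, this, coe_one']
  rcases (mem_Y z.1).1 z.2 with ⟨m, hm, h⟩ | h
  · rcases lt_trichotomy m n with hlt | rfl | hlt
    · exact hpos (hsep_pos n m hm hlt _ h h0)
    · rcases hz with hz | hz
      · obtain ⟨l, c, hl, hl1, hc, hc1, hcl, e⟩ := mem_C_pt m _ h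
        have hl0 : 0 < l := pt_pos m hm l c hl hc hc1 (e ▸ h0)
        have hs := pt_snd_lower m hm c hc hc1
        rw [Fmap, e, cf_pt m hm _ _ hl0.ne']
        rcases hcl with h | h | h
        · subst h; simp [cc]
        · subst h; simp [cc]
        · subst h; rw [e] at hz; simp only [pt] at hz; linarith
      · exact hneg (hsep_alpha _ _ hz h0)
    · exact hneg (hsep_neg (n + 1) m (by omega) hlt _ h h0)
  · exact hneg (hsep_alpha _ _ h h0)

lemma continuous_Fmap (n : ℕ) (hn : 2 ≤ n) : Continuous (Fmap n) := by
  have hc2 : Continuous fun z : ↥Yset => z.1.2 := by fun_prop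
  rw [continuous_iff_continuousAt]
  intro z
  by_cases h0 : z.1.2 = 0
  · have : Fmap n =ᶠ[𝓝 z] fun _ => 0 := by
      filter_upwards [(isOpen_lt hc2 continuous_const).mem_nhds
        (show z.1.2 < 1 / 2 by rw [h0]; norm_num)] with w hw
      exact Fmap_low n hn w (Or.inl hw)
    exact continuousAt_const.congr this.symm
  · have hden := den_pos n hn z.1 z.2 h0
    have h1 : ContinuousAt (fun z : ↥Yset => cf n z.1) z := by
      unfold cf
      exact ContinuousAt.div (by fun_prop) (by fun_prop) hden.ne'
    exact ((AddCircle.continuous_mk' (1 : ℝ)).comp continuous_cc).continuousAt.comp h1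

lemma gC_end (n : ℕ) (hn : 2 ≤ n) (s : ℝ) (hs : s = -1 ∨ s = 2) : gC n hn s = pY := by
  apply Subtype.ext
  have : lam s = 0 := by unfold lam; grind
  simp [gC, this, pt, pY, pp]

lemma gA_end (s : ℝ) (hs : s = -1 ∨ s = 2) : gA s = pY := by
  apply Subtype.ext
  have : lam s = 0 := by unfold lam; grind
  simp [gA, this, pY, pp]

/-- The loop around the `n`-th triangle. -/
def loopC (n : ℕ) (hn : 2 ≤ n) : Path pY pY where
  toFun t := gC n hn (3 * (t : ℝ) - 1)
  continuous_toFun := by fun_prop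
  source' := gC_end n hn _ (by norm_num)
  target' := gC_end n hn _ (by norm_num)

/-- The limit loop, running up and down `α`. -/
def loopA : Path pY pY where
  toFun t := gA (3 * (t : ℝ) - 1)
  continuous_toFun := by fun_prop
  source' := gA_end _ (by norm_num)
  target' := gA_end _ (by norm_num)

lemma Fmap_loopC (n : ℕ) (hn : 2 ≤ n) (t : I) :
    Fmap n (loopC n hn t) = ((cc (3 * (t : ℝ) - 1) : ℝ) : AddCircle (1 : ℝ)) := by
  by_cases hl : lam (3 * (t : ℝ) - 1) = 0
  · have h1 : loopC n hn t = pY := by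
      apply Subtype.ext
      change pt n (lam (3 * (t : ℝ) - 1)) _ = pp
      rw [hl]; simp [pt, pp]
    rw [h1, Fmap_low n hn pY (Or.inl (by norm_num [pY, pp]))]
    rcases cc_lam (3 * (t : ℝ) - 1) with h | h | h
    · rw [h]; simp
    · rw [h, coe_one']
    · rw [hl] at h; norm_num at h
  · change ((cc (cf n (pt n (lam (3 * (t : ℝ) - 1)) (cc (3 * (t : ℝ) - 1)))) : ℝ)
      : AddCircle (1 : ℝ)) = _
    rw [cf_pt n hn _ _ hl]
    congr 1
    have := cc_nonneg (3 * (t : ℝ) - 1)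
    have := cc_le (3 * (t : ℝ) - 1)
    generalize cc (3 * (t : ℝ) - 1) = u at *
    unfold cc; grind

lemma not_joined (n : ℕ) (hn : 2 ≤ n) : ¬ Joined (loopC n hn) loopA := by
  rintro ⟨P⟩
  have cov := AddCircle.isCoveringMap_coe (1 : ℝ)
  let F : C(↥Yset, AddCircle (1 : ℝ)) := ⟨Fmap n, continuous_Fmap n hn⟩
  let G0 : C(I, AddCircle (1 : ℝ)) := F.comp (loopC n hn : C(I, ↥Yset))
  let G1 : C(I, AddCircle (1 : ℝ)) := F.comp (loopA : C(I, ↥Yset))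
  have hom : (loopC n hn).Homotopic loopA := by
    refine ⟨⟨⟨⟨fun x => P x.1 x.2, ?_⟩, ?_, ?_⟩, ?_⟩⟩
    · exact Path.continuous_uncurry_iff.2 P.continuous
    · intro x; simp
    · intro x; simp
    · intro t x hx
      rcases hx with rfl | hx
      · simp
      · rw [Set.mem_singleton_iff] at hx; subst hx; simp
  have homF : G0.HomotopicRel G1 {0, 1} :=
    ContinuousMap.HomotopicRel.comp_continuousMap hom F
  have e1 : G1 = .const I 0 := by
    ext t
    exact Fmap_low n hn _ (Or.inr ((mem_alpha _).2 ⟨rfl, lam_nonneg _, lam_le _⟩))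
  have z0 : G0 0 = ((0 : ℝ) : AddCircle (1 : ℝ)) := by
    change Fmap n (loopC n hn 0) = _
    rw [Fmap_loopC]; norm_num [cc]
  have z1 : G1 0 = ((0 : ℝ) : AddCircle (1 : ℝ)) := by rw [e1]; simp
  have key := cov.liftPath_apply_one_eq_of_homotopicRel homF 0 z0 z1
  have l0 : (⟨fun t : I => cc (3 * (t : ℝ) - 1), continuous_cc.comp (by fun_prop)⟩ : C(I, ℝ))
      = cov.liftPath G0 0 z0 := by
    rw [cov.eq_liftPath_iff']
    refine ⟨funext fun t => (Fmap_loopC n hn t).symm, by norm_num [cc]⟩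
  have l1 : (ContinuousMap.const I (0 : ℝ)) = cov.liftPath G1 0 z1 := by
    rw [cov.eq_liftPath_iff']
    refine ⟨?_, rfl⟩
    rw [e1]; ext t; simp
  rw [← l0, ← l1] at key
  norm_num [cc] at key

lemma dist_loop (n : ℕ) (hn : 2 ≤ n) (t : I) : dist (loopC n hn t) (loopA t) ≤ 2 / n := by
  change dist (pt n (lam (3 * (t : ℝ) - 1)) (cc (3 * (t : ℝ) - 1))) (0, lam (3 * (t : ℝ) - 1)) ≤ _
  have h1 := lam_nonneg (3 * (t : ℝ) - 1)
  have h2 := lam_le (3 * (t : ℝ) - 1)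
  have h3 := cc_nonneg (3 * (t : ℝ) - 1)
  have h4 := cc_le (3 * (t : ℝ) - 1)
  generalize cc (3 * (t : ℝ) - 1) = c at *
  generalize lam (3 * (t : ℝ) - 1) = l at *
  have hn' : (2 : ℝ) ≤ n := by exact_mod_cast hn
  have hb := eps_bound n hn
  have he := eps_pos n
  have k0 : (n : ℝ) * n ≤ 100 * (n : ℝ) ^ 3 := by nlinarith [sq_nonneg (n : ℝ)]
  have k1 : eps n * n ≤ 1 / n := by
    rw [le_div_iff₀ (by linarith)]; nlinarith
  have k2 : eps n ≤ eps n * n := by nlinarith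
  have k3 : (0 : ℝ) < 1 / n := by positivity
  have k4 : (2 : ℝ) / n = 1 / n + 1 / n := by ring
  have k5 : c * (eps n * n) ≤ 1 * (eps n * n) := by gcongr
  have k6 : c * eps n ≤ 1 * eps n := by gcongr
  have k7 : 0 ≤ c * (eps n * n) := by positivity
  have k8 : 0 ≤ c * eps n := by positivity
  rw [Prod.dist_eq, Real.dist_eq, Real.dist_eq]
  simp only [pt]
  refine max_le (abs_le.2 ⟨?_, ?_⟩) (abs_le.2 ⟨?_, ?_⟩)
  · have : 0 ≤ l * (1 / n + c * (eps n * n)) := by positivity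
    linarith
  · have : l * (1 / n + c * (eps n * n)) ≤ 1 * (1 / n + c * (eps n * n)) := by gcongr
    linarith
  · have : l * (c * eps n) ≤ 1 * (c * eps n) := by gcongr
    linarith
  · have : 0 ≤ l * (c * eps n) := by positivity
    linarith

lemma tendsto_loop : Filter.Tendsto (fun k : ℕ => loopC (k + 2) (by omega)) Filter.atTop
    (𝓝 loopA) := by
  have hi : Topology.IsInducing (fun γ : Path pY pY => (γ : C(I, ↥Yset))) := ⟨rfl⟩
  rw [hi.tendsto_nhds_iff, tendsto_iff_dist_tendsto_zero]
  have hlim : Filter.Tendsto (fun k : ℕ => (2 : ℝ) / ((k + 2 : ℕ) : ℝ)) Filter.atTop (𝓝 0) :=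
    (tendsto_const_div_atTop_nhds_zero_nat 2).comp (Filter.tendsto_add_atTop_nat 2)
  refine squeeze_zero (fun _ => dist_nonneg) (fun k => ?_) hlim
  refine (ContinuousMap.dist_le (by positivity)).2 fun t => ?_
  exact dist_loop (k + 2) (by omega) t

lemma not_discrete : ¬ DiscreteTopology (piTop ↥Yset pY) := by
  intro hd
  have hc : Continuous (piMk : Path pY pY → piTop ↥Yset pY) := continuous_quotient_mk'
  have ho : IsOpen (piMk ⁻¹' {piMk loopA} : Set (Path pY pY)) :=
    (isOpen_discrete _).preimage hc
  obtain ⟨k, hk⟩ := (tendsto_loop.eventually (ho.mem_nhds rfl)).exists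
  exact not_joined (k + 2) (by omega) (Quotient.exact hk)

/-- `Y` is semilocally simply connected at every point (every point
has a neighborhood all of whose loops are null-homotopic in `Y`), yet `π₁(Y,p)`
is not discrete; so "discrete iff semilocally simply connected" is false in
general. -/
theorem Yset_semilocallySimplyConnected_but_pi1_not_discrete :
    (∀ y : ↥Yset, ∃ U ∈ 𝓝 y, ∀ γ : Path y y,
      (∀ t : I, γ t ∈ U) → γ.Homotopic (Path.refl y)) ∧
    ¬ DiscreteTopology (piTop ↥Yset pY) := by
  exact ⟨semiloc, not_discrete⟩
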